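/- Fix q ∈ ℂ nonzero and not a root of unity. Let F be the complex vector space of finitely supported functions ℕ → ℂ with basis {|m⟩}, and define linear operators b, c, k on F by b|m⟩ = |m+1⟩, c|m⟩ = (1−q^m)|m−1⟩ (with c|0⟩ = 0), k|m⟩ = q^m|m⟩. Then for all m, s ∈ ℕ: c^m ∘ b^s = Σ_{j=max(0,s−m)}^{s} q^{j(m−s+j)} (q^m;q^{−1})_{s−j} binom(s,j)_q · b^j ∘ c^{m−s+j}, where (z;q^{−1})_r = ∏_{l=0}^{r−1}(1 − z q^{−l}). -/

import Mathlib

/-- The q-Pochhammer symbol `(z;q)_m = ∏_{j=0}^{m-1} (1 - z q^j)`. -/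
noncomputable def qPoch (q z : ℂ) (m : ℕ) : ℂ := ∏ j ∈ Finset.range m, (1 - z * q ^ j)

/-- The q-binomial coefficient `binom(m,k)_q`. -/
noncomputable def qBinom (q : ℂ) (m k : ℕ) : ℂ :=
  if k ≤ m then qPoch q q m / (qPoch q q k * qPoch q q (m - k)) else 0

/-- `q` is not a root of unity. -/
def notRootOfUnity (q : ℂ) : Prop := ∀ m : ℕ, 0 < m → q ^ m ≠ 1

/-- The Fock space `F`, with basis `|m⟩`, `m ∈ ℕ`. -/
abbrev FockSp := ℕ →₀ ℂ

/-- The creation operator: `b|m⟩ = |m+1⟩`. -/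
noncomputable def opb : Module.End ℂ FockSp :=
  Finsupp.lsum ℂ fun m => LinearMap.toSpanSingleton ℂ FockSp (Finsupp.single (m + 1) 1)

/-- The annihilation operator: `c|m⟩ = (1−q^m)|m−1⟩` (so `c|0⟩ = 0`). -/
noncomputable def opc (q : ℂ) : Module.End ℂ FockSp :=
  Finsupp.lsum ℂ fun m => LinearMap.toSpanSingleton ℂ FockSp
    ((1 - q ^ m) • Finsupp.single (m - 1) 1)

/-- The number-type operator: `k|m⟩ = q^m|m⟩`. -/
noncomputable def opk (q : ℂ) : Module.End ℂ FockSp :=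
  Finsupp.lsum ℂ fun m => LinearMap.toSpanSingleton ℂ FockSp (q ^ m • Finsupp.single m 1)

theorem qPoch_succ (q z : ℂ) (n : ℕ) : qPoch q z (n + 1) = qPoch q z n * (1 - z * q ^ n) :=
  Finset.prod_range_succ _ _

theorem qPoch_self_ne_zero {q : ℂ} (hq : notRootOfUnity q) (n : ℕ) : qPoch q q n ≠ 0 := by
  refine Finset.prod_ne_zero_iff.2 fun j _ => ?_
  rw [← pow_succ', sub_ne_zero]
  exact (hq _ j.succ_pos).symm

theorem qPoch_inv_pow_succ {q : ℂ} (hq0 : q ≠ 0) {m r : ℕ} (h : r ≤ m) :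
    qPoch q⁻¹ (q ^ m) (r + 1) = qPoch q⁻¹ (q ^ m) r * (1 - q ^ (m - r)) := by
  rw [qPoch_succ, inv_pow, pow_sub₀ q hq0 h]

theorem qPoch_inv_pow_eq_zero {q : ℂ} (hq0 : q ≠ 0) {m r : ℕ} (h : m < r) :
    qPoch q⁻¹ (q ^ m) r = 0 := by
  refine Finset.prod_eq_zero (Finset.mem_range.2 h) ?_
  rw [inv_pow, mul_inv_cancel₀ (pow_ne_zero _ hq0), sub_self]

theorem qBinom_of_lt (q : ℂ) {n k : ℕ} (h : n < k) : qBinom q n k = 0 :=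
  if_neg h.not_ge

theorem qBinom_zero_right {q : ℂ} (hq : notRootOfUnity q) (n : ℕ) : qBinom q n 0 = 1 := by
  simp [qBinom, show qPoch q q 0 = 1 from Finset.prod_range_zero _, qPoch_self_ne_zero hq n]

theorem qBinom_self {q : ℂ} (hq : notRootOfUnity q) (n : ℕ) : qBinom q n n = 1 := by
  simp [qBinom, show qPoch q q 0 = 1 from Finset.prod_range_zero _, qPoch_self_ne_zero hq n]

theorem qBinom_symm (q : ℂ) {n k : ℕ} (h : k ≤ n) : qBinom q n (n - k) = qBinom q n k := by
  rw [qBinom, qBinom, if_pos (Nat.sub_le n k), if_pos h, Nat.sub_sub_self h, mul_comm (qPoch q q k)]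

/-- The `q`-Pascal rule. -/
theorem qBinom_succ_succ {q : ℂ} (hq : notRootOfUnity q) {n r : ℕ} (h : r ≤ n) :
    qBinom q (n + 1) (r + 1) = qBinom q n (r + 1) + q ^ (n - r) * qBinom q n r := by
  obtain rfl | h := h.eq_or_lt
  · simp [qBinom_self hq, qBinom_of_lt]
  obtain ⟨d, rfl⟩ := Nat.exists_eq_add_of_lt h
  have e₁ : r + d + 1 + 1 - (r + 1) = d + 1 := by lia
  have e₂ : r + d + 1 - (r + 1) = d := by lia
  have e₃ : r + d + 1 - r = d + 1 := by lia
  rw [qBinom, qBinom, qBinom, if_pos (by lia), if_pos (by lia), if_pos (by lia), e₁, e₂, e₃,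
    qPoch_succ q q (r + d + 1)]
  have hr := qPoch_self_ne_zero hq r
  have hr' := qPoch_self_ne_zero hq (r + 1)
  have hd := qPoch_self_ne_zero hq d
  have hd' := qPoch_self_ne_zero hq (d + 1)
  rw [qPoch_succ] at hr' hd'
  rw [qPoch_succ q q r, qPoch_succ q q d]
  have hr₁ := right_ne_zero_of_mul hr'
  have hd₁ := right_ne_zero_of_mul hd'
  field_simp
  ring

theorem opb_single (n : ℕ) (a : ℂ) :
    opb (Finsupp.single n a) = Finsupp.single (n + 1) a := by
  simp [opb]

theorem opc_single (q : ℂ) (n : ℕ) (a : ℂ) :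
    opc q (Finsupp.single n a) = Finsupp.single (n - 1) (a * (1 - q ^ n)) := by
  simp [opc, -Finsupp.single_mul, -Finsupp.single_sub]

theorem opc_mul_opb (q : ℂ) : opc q * opb = q • (opb * opc q) + (1 - q) • 1 := by
  refine Finsupp.lhom_ext fun n a => ?_
  simp only [Module.End.mul_apply, LinearMap.add_apply, LinearMap.smul_apply, Module.End.one_apply,
    opb_single, opc_single, Finsupp.smul_single, smul_eq_mul, Nat.add_sub_cancel]
  cases n with
  | zero => simp [mul_comm]
  | succ n =>
    rw [Nat.add_sub_cancel, ← Finsupp.single_add]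
    congr 1
    ring

theorem opc_pow_mul_opb (q : ℂ) (m : ℕ) :
    opc q ^ m * opb = q ^ m • (opb * opc q ^ m) + (1 - q ^ m) • opc q ^ (m - 1) := by
  induction m with
  | zero => simp
  | succ m ih =>
    have h : (1 - q ^ m) • (opc q * opc q ^ (m - 1)) = (1 - q ^ m) • opc q ^ m := by
      cases m with
      | zero => simp
      | succ m => rw [Nat.add_sub_cancel, ← pow_succ']
    rw [pow_succ', mul_assoc, ih, mul_add, mul_smul_comm, mul_smul_comm, h, ← mul_assoc,
      opc_mul_opb, add_mul, smul_mul_assoc, smul_mul_assoc, one_mul, mul_assoc, ← pow_succ',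
      Nat.add_sub_cancel]
    module

theorem opc_pow_mul_opb_pow {q : ℂ} (hq0 : q ≠ 0) (hq : notRootOfUnity q) (m s : ℕ) :
    opc q ^ m * opb ^ s
      = ∑ r ∈ Finset.range (s + 1),
          (q ^ ((s - r) * (m - r)) * qPoch q⁻¹ (q ^ m) r * qBinom q s r) •
            (opb ^ (s - r) * opc q ^ (m - r)) := by
  induction s with
  | zero => simp [qPoch, qBinom]
  | succ s ih =>
    let X : ℕ → Module.End ℂ FockSp := fun r =>
      (q ^ ((s + 1 - r) * (m - r)) * qPoch q⁻¹ (q ^ m) r * qBinom q s r) •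
        (opb ^ (s + 1 - r) * opc q ^ (m - r))
    let Y : ℕ → Module.End ℂ FockSp := fun r =>
      (q ^ ((s - r) * (m - r)) * qPoch q⁻¹ (q ^ m) (r + 1) * qBinom q s r) •
        (opb ^ (s - r) * opc q ^ (m - (r + 1)))
    have hX : X (s + 1) = 0 := by simp [X, qBinom_of_lt]
    have hL : ∀ r ∈ Finset.range (s + 1),
        (q ^ ((s - r) * (m - r)) * qPoch q⁻¹ (q ^ m) r * qBinom q s r) •
          (opb ^ (s - r) * opc q ^ (m - r)) * opb = X r + Y r := by
      intro r hr
      have hr : r ≤ s := by simpa [Nat.lt_succ_iff] using hr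
      obtain hm | hm := lt_or_ge m r
      · simp [X, Y, qPoch_inv_pow_eq_zero hq0 hm, qPoch_inv_pow_eq_zero hq0 (hm.trans r.lt_succ_self)]
      · simp only [X, Y]
        rw [qPoch_inv_pow_succ hq0 hm, smul_mul_assoc, mul_assoc (opb ^ (s - r)), opc_pow_mul_opb, mul_add,
          mul_smul_comm, mul_smul_comm, ← mul_assoc (opb ^ (s - r)), ← pow_succ, Nat.sub_sub,
          Nat.succ_sub hr, Nat.succ_mul, pow_add]
        module
    have hR : ∀ r ∈ Finset.range (s + 1),
        (q ^ ((s + 1 - (r + 1)) * (m - (r + 1))) * qPoch q⁻¹ (q ^ m) (r + 1) *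
          qBinom q (s + 1) (r + 1)) • (opb ^ (s + 1 - (r + 1)) * opc q ^ (m - (r + 1)))
          = X (r + 1) + Y r := by
      intro r hr
      have hr : r ≤ s := by simpa [Nat.lt_succ_iff] using hr
      obtain hm | hm := lt_or_ge m (r + 1)
      · simp [X, Y, qPoch_inv_pow_eq_zero hq0 hm]
      · simp only [X, Y]
        have e : m - r = m - (r + 1) + 1 := by lia
        rw [qBinom_succ_succ hq hr, Nat.add_sub_add_right, e, Nat.mul_succ, pow_add]
        module
    rw [pow_succ, ← mul_assoc, ih, Finset.sum_mul, Finset.sum_congr rfl hL,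
      Finset.sum_range_succ' _ (s + 1), Finset.sum_congr rfl hR, Finset.sum_add_distrib,
      Finset.sum_add_distrib, ← add_zero (∑ r ∈ Finset.range (s + 1), X r), ← hX,
      ← Finset.sum_range_succ, Finset.sum_range_succ']
    simp only [X, qBinom_zero_right hq]
    abel

/-- Normal ordering: `c^m ∘ b^s = Σ_{j=max(0,s−m)}^{s} q^{j(m−s+j)} (q^m;q^{−1})_{s−j}
binom(s,j)_q · b^j ∘ c^{m−s+j}`, where `(z;q^{−1})_r = ∏_{l=0}^{r−1}(1 − z q^{−l})`. -/
theorem c_pow_comp_b_pow (q : ℂ) (hq0 : q ≠ 0) (hq : notRootOfUnity q) (m s : ℕ) :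
    (opc q) ^ m * opb ^ s
      = ∑ j ∈ Finset.Icc (s - m) s,
          (q ^ (j * (m + j - s)) * qPoch q⁻¹ (q ^ m) (s - j) * qBinom q s j) •
            (opb ^ j * (opc q) ^ (m + j - s)) := by
  rw [opc_pow_mul_opb_pow hq0 hq, ← Finset.sum_range_reflect]
  symm
  refine Finset.sum_subset_zero_on_sdiff (fun j hj => ?_) (fun j hj => ?_) fun j hj => ?_
  · simp only [Finset.mem_Icc, Finset.mem_range] at hj ⊢
    lia
  · simp only [Finset.mem_sdiff, Finset.mem_Icc, Finset.mem_range] at hj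
    rw [Nat.add_sub_cancel, qPoch_inv_pow_eq_zero hq0 (by lia), mul_zero, zero_mul, zero_smul]
  · rw [Finset.mem_Icc] at hj
    have e : m - (s - j) = m + j - s := by lia
    rw [Nat.add_sub_cancel, Nat.sub_sub_self hj.2, qBinom_symm q hj.2, e]
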